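/- arXiv:2304.10342 — 4 statements merged into one kernel-verified Lean document; each statement's English description precedes it below -/
import Mathlib

section
/- Assume (x*,u*) is an optimal pair and v* ∈ ℝ. Then for every t ∈ [0,T], v→(x*(t),t) + v←(x*(t),t) = v*; in particular, for every t ∈ [0,T], every point of Γ*_t attains the supremum ⨆_{x ∈ X} (v→(x,t) + v←(x,t)). -/
open MeasureTheory Set

noncomputable section

/-- An admissible pair `(y,u)` on the time interval `[t₀,t₁]`: the control `u` is
measurable with values in `U`, the trajectory `y` stays in `X`, and `y` is absolutely
continuous with `y'(s) = f (y s) (u s)` for a.e. `s ∈ [t₀,t₁]` (expressed by the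
integral representation). -/
def IsAdmissible {d m : ℕ} (X : Set (EuclideanSpace ℝ (Fin d)))
    (U : Set (EuclideanSpace ℝ (Fin m)))
    (f : EuclideanSpace ℝ (Fin d) → EuclideanSpace ℝ (Fin m) → EuclideanSpace ℝ (Fin d))
    (t₀ t₁ : ℝ) (y : ℝ → EuclideanSpace ℝ (Fin d))
    (u : ℝ → EuclideanSpace ℝ (Fin m)) : Prop :=
  Measurable u ∧ (∀ s ∈ Icc t₀ t₁, u s ∈ U) ∧ (∀ s ∈ Icc t₀ t₁, y s ∈ X) ∧
    ∀ t ∈ Icc t₀ t₁, y t = y t₀ + ∫ s in t₀..t, f (y s) (u s)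

/-- The optimal value `v*` of the finite-horizon problem, as an extended real. -/
def vStar {d m : ℕ} (X : Set (EuclideanSpace ℝ (Fin d)))
    (U : Set (EuclideanSpace ℝ (Fin m)))
    (f : EuclideanSpace ℝ (Fin d) → EuclideanSpace ℝ (Fin m) → EuclideanSpace ℝ (Fin d))
    (ℓ : EuclideanSpace ℝ (Fin d) → EuclideanSpace ℝ (Fin m) → ℝ)
    (φ₀ φT : EuclideanSpace ℝ (Fin d) → ℝ) (T : ℝ) : EReal :=
  ⨆ (p : (ℝ → EuclideanSpace ℝ (Fin d)) × (ℝ → EuclideanSpace ℝ (Fin m)))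
    (_ : IsAdmissible X U f 0 T p.1 p.2),
      (((∫ s in (0:ℝ)..T, ℓ (p.1 s) (p.2 s)) + φ₀ (p.1 0) + φT (p.1 T) : ℝ) : EReal)

/-- The backward value function `v←(x,t)`. -/
def vBack {d m : ℕ} (X : Set (EuclideanSpace ℝ (Fin d)))
    (U : Set (EuclideanSpace ℝ (Fin m)))
    (f : EuclideanSpace ℝ (Fin d) → EuclideanSpace ℝ (Fin m) → EuclideanSpace ℝ (Fin d))
    (ℓ : EuclideanSpace ℝ (Fin d) → EuclideanSpace ℝ (Fin m) → ℝ)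
    (φT : EuclideanSpace ℝ (Fin d) → ℝ) (T : ℝ)
    (x : EuclideanSpace ℝ (Fin d)) (t : ℝ) : EReal :=
  ⨆ (p : (ℝ → EuclideanSpace ℝ (Fin d)) × (ℝ → EuclideanSpace ℝ (Fin m)))
    (_ : IsAdmissible X U f t T p.1 p.2 ∧ p.1 t = x),
      (((∫ s in t..T, ℓ (p.1 s) (p.2 s)) + φT (p.1 T) : ℝ) : EReal)

/-- The forward value function `v→(x,t)`. -/
def vFor {d m : ℕ} (X : Set (EuclideanSpace ℝ (Fin d)))
    (U : Set (EuclideanSpace ℝ (Fin m)))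
    (f : EuclideanSpace ℝ (Fin d) → EuclideanSpace ℝ (Fin m) → EuclideanSpace ℝ (Fin d))
    (ℓ : EuclideanSpace ℝ (Fin d) → EuclideanSpace ℝ (Fin m) → ℝ)
    (φ₀ : EuclideanSpace ℝ (Fin d) → ℝ)
    (x : EuclideanSpace ℝ (Fin d)) (t : ℝ) : EReal :=
  ⨆ (p : (ℝ → EuclideanSpace ℝ (Fin d)) × (ℝ → EuclideanSpace ℝ (Fin m)))
    (_ : IsAdmissible X U f 0 t p.1 p.2 ∧ p.1 t = x),
      (((∫ s in (0:ℝ)..t, ℓ (p.1 s) (p.2 s)) + φ₀ (p.1 0) : ℝ) : EReal)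

namespace IsAdmissible

variable {d m : ℕ} {X : Set (EuclideanSpace ℝ (Fin d))} {U : Set (EuclideanSpace ℝ (Fin m))}
  {f : EuclideanSpace ℝ (Fin d) → EuclideanSpace ℝ (Fin m) → EuclideanSpace ℝ (Fin d)}
  {t₀ t t₁ : ℝ} {y y₁ y₂ : ℝ → EuclideanSpace ℝ (Fin d)}
  {u u₁ u₂ : ℝ → EuclideanSpace ℝ (Fin m)}

/-- The trajectory of an admissible pair is a.e. strongly measurable, whether or not the
velocity is known to be integrable: it is continuous as long as the velocity is integrable, and
constant afterwards. -/
theorem aestronglyMeasurable_trajectory (h : IsAdmissible X U f t₀ t₁ y u) :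
    AEStronglyMeasurable y (volume.restrict (Ioc t₀ t₁)) := by
  obtain ⟨-, -, -, hy⟩ := h
  set A : Set ℝ := {t | t ∈ Ioc t₀ t₁ ∧ IntervalIntegrable (fun s => f (y s) (u s)) volume t₀ t}
    with hA
  have hcont : ∀ s ∈ A, ContinuousOn y (Icc t₀ s) := by
    intro s hs
    have h1 := (intervalIntegral.continuousOn_primitive_interval' hs.2 left_mem_uIcc).const_add
      (y t₀)
    rw [uIcc_of_le hs.1.1.le] at h1
    exact h1.congr fun r hr => hy r ⟨hr.1, hr.2.trans hs.1.2⟩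
  have hord : A.OrdConnected := by
    refine ⟨fun a ha b hb c hc => ⟨⟨ha.1.1.trans_le hc.1, hc.2.trans hb.1.2⟩, ?_⟩⟩
    refine hb.2.mono_set ?_
    rw [uIcc_of_le (ha.1.1.le.trans hc.1), uIcc_of_le hb.1.1.le]
    exact Icc_subset_Icc_right hc.2
  have hmeas : MeasurableSet A := hord.measurableSet
  have hAcont : ContinuousOn y A := by
    intro x hx
    by_cases hlt : ∃ s ∈ A, x < s
    · obtain ⟨s, hs, hxs⟩ := hlt
      exact ((hcont s hs).continuousAt (Icc_mem_nhds hx.1.1 hxs)).continuousWithinAt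
    · push Not at hlt
      exact (hcont x hx x ⟨hx.1.1.le, le_rfl⟩).mono fun s hs => ⟨hs.1.1.le, hlt s hs⟩
  have hunion : Ioc t₀ t₁ = A ∪ (Ioc t₀ t₁ \ A) :=
    (union_sdiff_cancel fun s hs => hs.1).symm
  rw [hunion, aestronglyMeasurable_union_iff]
  refine ⟨hAcont.aestronglyMeasurable hmeas, ?_⟩
  refine (aestronglyMeasurable_const (b := y t₀)).congr ?_
  filter_upwards [ae_restrict_mem (measurableSet_Ioc.diff hmeas)] with s hs
  rw [hy s (Ioc_subset_Icc_self hs.1),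
    intervalIntegral.integral_undef fun hint => hs.2 ⟨hs.1, hint⟩, add_zero]

/-- A bounded continuous function is integrable along an admissible pair. -/
theorem intervalIntegrable_comp {F : Type*} [NormedAddCommGroup F]
    (h : IsAdmissible X U f t₀ t₁ y u) (ht : t₀ ≤ t₁)
    {g : EuclideanSpace ℝ (Fin d) → EuclideanSpace ℝ (Fin m) → F}
    (hgc : Continuous fun p : EuclideanSpace ℝ (Fin d) × EuclideanSpace ℝ (Fin m) => g p.1 p.2)
    (hgb : ∃ C, ∀ x v, ‖g x v‖ ≤ C) :
    IntervalIntegrable (fun s => g (y s) (u s)) volume t₀ t₁ := by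
  obtain ⟨C, hC⟩ := hgb
  rw [intervalIntegrable_iff_integrableOn_Ioc_of_le ht]
  have hmeas : AEStronglyMeasurable (fun s => g (y s) (u s)) (volume.restrict (Ioc t₀ t₁)) :=
    hgc.comp_aestronglyMeasurable
      (h.aestronglyMeasurable_trajectory.prodMk h.1.aestronglyMeasurable)
  exact Integrable.of_bound hmeas C (ae_of_all _ fun s => hC _ _)

theorem restrict_left (h : IsAdmissible X U f t₀ t₁ y u) (ht : t ≤ t₁) :
    IsAdmissible X U f t₀ t y u :=
  have hsub : Icc t₀ t ⊆ Icc t₀ t₁ := Icc_subset_Icc_right ht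
  ⟨h.1, fun s hs => h.2.1 s (hsub hs), fun s hs => h.2.2.1 s (hsub hs),
    fun s hs => h.2.2.2 s (hsub hs)⟩

theorem restrict_right (h : IsAdmissible X U f t₀ t₁ y u) (ht : t ∈ Icc t₀ t₁)
    (hint : IntervalIntegrable (fun s => f (y s) (u s)) volume t₀ t₁) :
    IsAdmissible X U f t t₁ y u := by
  have hsub : Icc t t₁ ⊆ Icc t₀ t₁ := Icc_subset_Icc_left ht.1
  refine ⟨h.1, fun s hs => h.2.1 s (hsub hs), fun s hs => h.2.2.1 s (hsub hs), fun s hs => ?_⟩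
  have hmono : ∀ a ∈ Icc t₀ t₁, ∀ b ∈ Icc t₀ t₁,
      IntervalIntegrable (fun s => f (y s) (u s)) volume a b := fun a ha b hb =>
    hint.mono_set (by rw [uIcc_of_le (ht.1.trans ht.2)]; exact uIcc_subset_Icc ha hb)
  have h₀ : t₀ ∈ Icc t₀ t₁ := left_mem_Icc.2 (ht.1.trans ht.2)
  rw [h.2.2.2 s (hsub hs), h.2.2.2 t ht, add_assoc,
    intervalIntegral.integral_add_adjacent_intervals (hmono _ h₀ _ ht) (hmono _ ht _ (hsub hs))]

theorem integral_concat_left {F : Type*} [NormedAddCommGroup F] [NormedSpace ℝ F]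
    (g : EuclideanSpace ℝ (Fin d) → EuclideanSpace ℝ (Fin m) → F) {r : ℝ}
    (h₀ : t₀ ≤ r) (hr : r ≤ t) :
    ∫ s in t₀..r, g ((Iic t).piecewise y₁ y₂ s) ((Iic t).piecewise u₁ u₂ s) =
      ∫ s in t₀..r, g (y₁ s) (u₁ s) := by
  refine intervalIntegral.integral_congr fun s hs => ?_
  rw [uIcc_of_le h₀] at hs
  have hmem : s ∈ Iic t := hs.2.trans hr
  simp only [piecewise_eq_of_mem _ _ _ hmem]

theorem integral_concat_right {F : Type*} [NormedAddCommGroup F] [NormedSpace ℝ F]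
    (g : EuclideanSpace ℝ (Fin d) → EuclideanSpace ℝ (Fin m) → F) {r : ℝ} (hr : t ≤ r) :
    ∫ s in t..r, g ((Iic t).piecewise y₁ y₂ s) ((Iic t).piecewise u₁ u₂ s) =
      ∫ s in t..r, g (y₂ s) (u₂ s) := by
  refine intervalIntegral.integral_congr_ae (ae_of_all _ fun s hs => ?_)
  rw [uIoc_of_le hr] at hs
  have hmem : s ∉ Iic t := not_le.2 hs.1
  simp only [piecewise_eq_of_notMem _ _ _ hmem]

theorem integral_concat {F : Type*} [NormedAddCommGroup F] [NormedSpace ℝ F]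
    {g : EuclideanSpace ℝ (Fin d) → EuclideanSpace ℝ (Fin m) → F} {r : ℝ}
    (h₀ : t₀ ≤ t) (hr : t ≤ r)
    (h₁ : IntervalIntegrable (fun s => g (y₁ s) (u₁ s)) volume t₀ t)
    (h₂ : IntervalIntegrable (fun s => g (y₂ s) (u₂ s)) volume t r) :
    ∫ s in t₀..r, g ((Iic t).piecewise y₁ y₂ s) ((Iic t).piecewise u₁ u₂ s) =
      (∫ s in t₀..t, g (y₁ s) (u₁ s)) + ∫ s in t..r, g (y₂ s) (u₂ s) := by
  rw [← intervalIntegral.integral_add_adjacent_intervals (b := t), integral_concat_left g h₀ le_rfl,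
    integral_concat_right g hr]
  · refine h₁.congr fun s hs => ?_
    rw [uIoc_of_le h₀] at hs
    have hmem : s ∈ Iic t := hs.2
    simp only [piecewise_eq_of_mem _ _ _ hmem]
  · refine h₂.congr fun s hs => ?_
    rw [uIoc_of_le hr] at hs
    have hmem : s ∉ Iic t := not_le.2 hs.1
    simp only [piecewise_eq_of_notMem _ _ _ hmem]

/-- Two admissible pairs that meet at time `t` can be concatenated. -/
theorem concat (h₁ : IsAdmissible X U f t₀ t y₁ u₁) (h₂ : IsAdmissible X U f t t₁ y₂ u₂)
    (ht : t ∈ Icc t₀ t₁) (hmeet : y₁ t = y₂ t)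
    (hint₁ : IntervalIntegrable (fun s => f (y₁ s) (u₁ s)) volume t₀ t)
    (hint₂ : IntervalIntegrable (fun s => f (y₂ s) (u₂ s)) volume t t₁) :
    IsAdmissible X U f t₀ t₁ ((Iic t).piecewise y₁ y₂) ((Iic t).piecewise u₁ u₂) := by
  have hinit : (Iic t).piecewise y₁ y₂ t₀ = y₁ t₀ := piecewise_eq_of_mem _ _ _ ht.1
  refine ⟨h₁.1.piecewise measurableSet_Iic h₂.1, fun s hs => ?_, fun s hs => ?_, fun s hs => ?_⟩
  · by_cases hst : s ∈ Iic t
    · rw [piecewise_eq_of_mem _ _ _ hst]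
      exact h₁.2.1 s ⟨hs.1, hst⟩
    · rw [piecewise_eq_of_notMem _ _ _ hst]
      exact h₂.2.1 s ⟨(not_le.1 hst).le, hs.2⟩
  · by_cases hst : s ∈ Iic t
    · rw [piecewise_eq_of_mem _ _ _ hst]
      exact h₁.2.2.1 s ⟨hs.1, hst⟩
    · rw [piecewise_eq_of_notMem _ _ _ hst]
      exact h₂.2.2.1 s ⟨(not_le.1 hst).le, hs.2⟩
  · by_cases hst : s ∈ Iic t
    · rw [integral_concat_left f hs.1 hst, hinit, piecewise_eq_of_mem _ _ _ hst]
      exact h₁.2.2.2 s ⟨hs.1, hst⟩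
    · have hts : t ≤ s := (not_le.1 hst).le
      have hint₂' : IntervalIntegrable (fun s => f (y₂ s) (u₂ s)) volume t s := by
        refine hint₂.mono_set ?_
        rw [uIcc_of_le hts, uIcc_of_le ht.2]
        exact Icc_subset_Icc_right hs.2
      rw [integral_concat ht.1 hts hint₁ hint₂', hinit, piecewise_eq_of_notMem _ _ _ hst,
        h₂.2.2.2 s ⟨hts, hs.2⟩, ← hmeet, h₁.2.2.2 t ⟨ht.1, le_rfl⟩, add_assoc]

end IsAdmissible

section ValueFunctions

variable {d m : ℕ} {X : Set (EuclideanSpace ℝ (Fin d))} {U : Set (EuclideanSpace ℝ (Fin m))}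
  {f : EuclideanSpace ℝ (Fin d) → EuclideanSpace ℝ (Fin m) → EuclideanSpace ℝ (Fin d)}
  {ℓ : EuclideanSpace ℝ (Fin d) → EuclideanSpace ℝ (Fin m) → ℝ}
  {T t : ℝ}

theorem vFor_add_vBack_le_vStar
    (hℓc : Continuous fun p : EuclideanSpace ℝ (Fin d) × EuclideanSpace ℝ (Fin m) => ℓ p.1 p.2)
    (hℓb : ∃ C, ∀ x u, |ℓ x u| ≤ C)
    (hfc : Continuous fun p : EuclideanSpace ℝ (Fin d) × EuclideanSpace ℝ (Fin m) => f p.1 p.2)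
    (hfb : ∃ C, ∀ x u, ‖f x u‖ ≤ C) (φ₀ φT : EuclideanSpace ℝ (Fin d) → ℝ)
    (ht : t ∈ Icc 0 T) (x : EuclideanSpace ℝ (Fin d)) :
    vFor X U f ℓ φ₀ x t + vBack X U f ℓ φT T x t ≤ vStar X U f ℓ φ₀ φT T := by
  refine EReal.add_le_of_forall_lt fun a ha b hb => ?_
  simp only [vFor, lt_iSup_iff] at ha
  simp only [vBack, lt_iSup_iff] at hb
  obtain ⟨⟨y₁, u₁⟩, ⟨h₁, hx₁⟩, ha⟩ := ha
  obtain ⟨⟨y₂, u₂⟩, ⟨h₂, hx₂⟩, hb⟩ := hb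
  dsimp only at h₁ h₂ hx₁ hx₂ ha hb
  have hmeet : y₁ t = y₂ t := hx₁.trans hx₂.symm
  have hadm := h₁.concat h₂ ht hmeet (h₁.intervalIntegrable_comp ht.1 hfc hfb)
    (h₂.intervalIntegrable_comp ht.2 hfc hfb)
  have hpayoff : (((∫ s in (0:ℝ)..T, ℓ ((Iic t).piecewise y₁ y₂ s) ((Iic t).piecewise u₁ u₂ s))
      + φ₀ ((Iic t).piecewise y₁ y₂ 0) + φT ((Iic t).piecewise y₁ y₂ T) : ℝ) : EReal)
      ≤ vStar X U f ℓ φ₀ φT T := le_iSup₂_of_le (_, _) hadm le_rfl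
  refine (add_le_add ha.le hb.le).trans (le_trans (le_of_eq ?_) hpayoff)
  have hT : (Iic t).piecewise y₁ y₂ T = y₂ T := by
    rcases ht.2.eq_or_lt with rfl | hlt
    · rw [piecewise_eq_of_mem _ _ _ (mem_Iic.2 le_rfl), hmeet]
    · exact piecewise_eq_of_notMem _ _ _ (not_le.2 hlt)
  rw [IsAdmissible.integral_concat ht.1 ht.2 (h₁.intervalIntegrable_comp ht.1 hℓc hℓb)
    (h₂.intervalIntegrable_comp ht.2 hℓc hℓb), hT,
    piecewise_eq_of_mem _ _ _ (mem_Iic.2 ht.1), ← EReal.coe_add, EReal.coe_eq_coe_iff]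
  ring

theorem payoff_le_vFor_add_vBack
    (hℓc : Continuous fun p : EuclideanSpace ℝ (Fin d) × EuclideanSpace ℝ (Fin m) => ℓ p.1 p.2)
    (hℓb : ∃ C, ∀ x u, |ℓ x u| ≤ C)
    (hfc : Continuous fun p : EuclideanSpace ℝ (Fin d) × EuclideanSpace ℝ (Fin m) => f p.1 p.2)
    (hfb : ∃ C, ∀ x u, ‖f x u‖ ≤ C) (φ₀ φT : EuclideanSpace ℝ (Fin d) → ℝ)
    (ht : t ∈ Icc 0 T) {y : ℝ → EuclideanSpace ℝ (Fin d)} {u : ℝ → EuclideanSpace ℝ (Fin m)}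
    (h : IsAdmissible X U f 0 T y u) :
    (((∫ s in (0:ℝ)..T, ℓ (y s) (u s)) + φ₀ (y 0) + φT (y T) : ℝ) : EReal) ≤
      vFor X U f ℓ φ₀ (y t) t + vBack X U f ℓ φT T (y t) t := by
  have h₁ : IsAdmissible X U f 0 t y u := h.restrict_left ht.2
  have h₂ : IsAdmissible X U f t T y u :=
    h.restrict_right ht (h.intervalIntegrable_comp (ht.1.trans ht.2) hfc hfb)
  have hFor : (((∫ s in (0:ℝ)..t, ℓ (y s) (u s)) + φ₀ (y 0) : ℝ) : EReal) ≤
      vFor X U f ℓ φ₀ (y t) t := le_iSup₂_of_le (y, u) ⟨h₁, rfl⟩ le_rfl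
  have hBack : (((∫ s in t..T, ℓ (y s) (u s)) + φT (y T) : ℝ) : EReal) ≤
      vBack X U f ℓ φT T (y t) t := le_iSup₂_of_le (y, u) ⟨h₂, rfl⟩ le_rfl
  refine le_trans (le_of_eq ?_) (add_le_add hFor hBack)
  rw [← EReal.coe_add, EReal.coe_eq_coe_iff, ← intervalIntegral.integral_add_adjacent_intervals
    (h₁.intervalIntegrable_comp ht.1 hℓc hℓb) (h₂.intervalIntegrable_comp ht.2 hℓc hℓb)]
  ring

end ValueFunctions

/-- Proposition 2.2, second part: if `(x*,u*)` is an optimal pair and `v* ∈ ℝ`, then for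
every `t ∈ [0,T]`, `v→(x*(t),t) + v←(x*(t),t) = v*`; in particular every point of `Γ*_t`
attains the supremum `⨆ x ∈ X, (v→(x,t) + v←(x,t))`. -/
theorem optimal_trajectory_attains_sup {d m : ℕ}
    (T : ℝ) (hT : 0 < T)
    (X : Set (EuclideanSpace ℝ (Fin d))) (hX : Bornology.IsBounded X)
    (U : Set (EuclideanSpace ℝ (Fin m)))
    (ℓ : EuclideanSpace ℝ (Fin d) → EuclideanSpace ℝ (Fin m) → ℝ)
    (hℓc : Continuous fun p : EuclideanSpace ℝ (Fin d) × EuclideanSpace ℝ (Fin m) => ℓ p.1 p.2)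
    (hℓb : ∃ C, ∀ x u, |ℓ x u| ≤ C)
    (f : EuclideanSpace ℝ (Fin d) → EuclideanSpace ℝ (Fin m) → EuclideanSpace ℝ (Fin d))
    (hfc : Continuous fun p : EuclideanSpace ℝ (Fin d) × EuclideanSpace ℝ (Fin m) => f p.1 p.2)
    (hfb : ∃ C, ∀ x u, ‖f x u‖ ≤ C)
    (φ₀ φT : EuclideanSpace ℝ (Fin d) → ℝ)
    (hφ₀c : Continuous φ₀) (hφ₀b : ∃ C, ∀ x, |φ₀ x| ≤ C)
    (hφTc : Continuous φT) (hφTb : ∃ C, ∀ x, |φT x| ≤ C)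
    (xs : ℝ → EuclideanSpace ℝ (Fin d)) (us : ℝ → EuclideanSpace ℝ (Fin m))
    (hadm : IsAdmissible X U f 0 T xs us)
    (hopt : (((∫ s in (0:ℝ)..T, ℓ (xs s) (us s)) + φ₀ (xs 0) + φT (xs T) : ℝ) : EReal)
      = vStar X U f ℓ φ₀ φT T)
    (hfin : ∃ r : ℝ, vStar X U f ℓ φ₀ φT T = (r : EReal)) :
    (∀ t ∈ Icc (0:ℝ) T,
      vFor X U f ℓ φ₀ (xs t) t + vBack X U f ℓ φT T (xs t) t = vStar X U f ℓ φ₀ φT T) ∧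
    (∀ t ∈ Icc (0:ℝ) T,
      ∀ z : EuclideanSpace ℝ (Fin d),
        (∃ ys us', IsAdmissible X U f 0 T ys us' ∧
          (((∫ s in (0:ℝ)..T, ℓ (ys s) (us' s)) + φ₀ (ys 0) + φT (ys T) : ℝ) : EReal)
            = vStar X U f ℓ φ₀ φT T ∧ ys t = z) →
        vFor X U f ℓ φ₀ z t + vBack X U f ℓ φT T z t =
          ⨆ x ∈ X, (vFor X U f ℓ φ₀ x t + vBack X U f ℓ φT T x t)) := by
  have hle := fun t (ht : t ∈ Icc (0:ℝ) T) x =>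
    vFor_add_vBack_le_vStar (X := X) (U := U) hℓc hℓb hfc hfb φ₀ φT ht x
  refine ⟨fun t ht => le_antisymm (hle t ht _) ?_, ?_⟩
  · rw [← hopt]
    exact payoff_le_vFor_add_vBack hℓc hℓb hfc hfb φ₀ φT ht hadm
  · rintro t ht z ⟨ys, us', hys, hval, rfl⟩
    refine le_antisymm (le_iSup₂_of_le (ys t) (hys.2.2.1 t ht) le_rfl)
      (iSup₂_le fun x _ => (hle t ht x).trans ?_)
    rw [← hval]
    exact payoff_le_vFor_add_vBack hℓc hℓb hfc hfb φ₀ φT ht hys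
end
end

section
/- The map Π := B ∘ (C ∘ B)^♯ ∘ C is a projector: Π ∘ Π = Π. -/
noncomputable section

/-- The residualMap map `g^♯` of a map `g` between complete lattices:
`g^♯(q) := sSup {p | g p ≤ q}`. -/
def residualMap {α β : Type*} [CompleteLattice α] [CompleteLattice β] (g : α → β) : β → α :=
  fun q => sSup {p | g p ≤ q}

theorem gc_residualMap {α β : Type*} [CompleteLattice α] [CompleteLattice β] {g : α → β}
    (hg : ∀ S : Set α, g (sSup S) = sSup (g '' S)) : GaloisConnection g (residualMap g) := by
  have hmono : Monotone g := OrderHomClass.mono (⟨g, hg⟩ : sSupHom α β)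
  refine fun p q => ⟨fun h => le_sSup h, fun h => (hmono h).trans ?_⟩
  rw [residualMap, hg]
  exact sSup_le (Set.forall_mem_image.2 fun _ hx => hx)

/-- For sup-preserving maps `B : 𝒰 → 𝒳` and `C : 𝒳 → 𝒴` between complete lattices, the map
`Π = B ∘ (C ∘ B)^♯ ∘ C` is a projector: `Π ∘ Π = Π`. -/
theorem projector_idempotent {𝒰 𝒳 𝒴 : Type*}
    [CompleteLattice 𝒰] [CompleteLattice 𝒳] [CompleteLattice 𝒴]
    (B : 𝒰 → 𝒳) (C : 𝒳 → 𝒴)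
    (hB : ∀ S : Set 𝒰, B (sSup S) = sSup (B '' S))
    (hC : ∀ S : Set 𝒳, C (sSup S) = sSup (C '' S)) :
    (B ∘ residualMap (C ∘ B) ∘ C) ∘ (B ∘ residualMap (C ∘ B) ∘ C)
      = B ∘ residualMap (C ∘ B) ∘ C := by
  have gc : GaloisConnection (C ∘ B) (residualMap (C ∘ B)) :=
    gc_residualMap fun S => by
      rw [Function.comp_apply, hB, hC, Set.image_comp]
  funext x
  exact congrArg B (gc.u_l_u_eq_u (C x))
end
end

section
/- For every x ∈ 𝒳, Π(x) is the greatest element of the set {y ∈ 𝒳 | y ∈ range B and C y ≤ C x}; that is, Π(x) belongs to the range of B, C(Π(x)) ≤ C(x), and every y in the range of B with C y ≤ C x satisfies y ≤ Π(x). -/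
noncomputable section

/-- For sup-preserving maps `B : 𝒰 → 𝒳` and `C : 𝒳 → 𝒴` between complete lattices, and
`Π = B ∘ (C ∘ B)^♯ ∘ C`, the element `Π x` is the greatest element of
`{y ∈ range B | C y ≤ C x}`. -/
theorem projector_is_max {𝒰 𝒳 𝒴 : Type*}
    [CompleteLattice 𝒰] [CompleteLattice 𝒳] [CompleteLattice 𝒴]
    (B : 𝒰 → 𝒳) (C : 𝒳 → 𝒴)
    (hB : ∀ S : Set 𝒰, B (sSup S) = sSup (B '' S))
    (hC : ∀ S : Set 𝒳, C (sSup S) = sSup (C '' S))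
    (x : 𝒳) :
    (B ∘ residualMap (C ∘ B) ∘ C) x ∈ Set.range B ∧
    C ((B ∘ residualMap (C ∘ B) ∘ C) x) ≤ C x ∧
    ∀ y ∈ Set.range B, C y ≤ C x → y ≤ (B ∘ residualMap (C ∘ B) ∘ C) x := by
  refine ⟨⟨_, rfl⟩, ?_, ?_⟩
  · simp only [Function.comp_apply, residualMap]
    rw [hB, hC]
    refine sSup_le ?_
    rintro _ ⟨_, ⟨p, hp, rfl⟩, rfl⟩
    exact hp
  · rintro _ ⟨u, rfl⟩ hu
    simp only [Function.comp_apply, residualMap]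
    rw [hB]
    exact le_sSup ⟨u, hu, rfl⟩
end
end

section
/- Dynamic programming principle for the backward value function: for every x ∈ ℝ^d and all 0 ≤ t₀ ≤ t₁ ≤ T, v←(x,t₀) equals the supremum, in the extended reals, over admissible pairs (y,u) on [t₀,t₁] with y(t₀) = x, of ∫_{t₀}^{t₁} ℓ(y(s),u(s)) ds + v←(y(t₁), t₁). -/
open MeasureTheory Set

noncomputable section

section Admissible

variable {d m : ℕ} {X : Set (EuclideanSpace ℝ (Fin d))} {U : Set (EuclideanSpace ℝ (Fin m))}
  {f : EuclideanSpace ℝ (Fin d) → EuclideanSpace ℝ (Fin m) → EuclideanSpace ℝ (Fin d)}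
  {a b c : ℝ} {y z : ℝ → EuclideanSpace ℝ (Fin d)} {u w : ℝ → EuclideanSpace ℝ (Fin m)}

/-- A trajectory is measurable even though `IsAdmissible` does not ask for integrability of the
velocity: beyond the times up to which the velocity is integrable, the integral takes its default
value `0` and the trajectory is constant. -/
theorem IsAdmissible.aestronglyMeasurable (h : IsAdmissible X U f a b y u)
    (hfb : ∃ C, ∀ x v, ‖f x v‖ ≤ C) :
    AEStronglyMeasurable y (volume.restrict (Icc a b)) := by
  obtain ⟨-, -, -, hy⟩ := h
  obtain ⟨C, hC⟩ := hfb
  set A : Set ℝ := {t ∈ Icc a b | IntervalIntegrable (fun s => f (y s) (u s)) volume a t}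
  have hA_meas : MeasurableSet A := by
    refine OrdConnected.measurableSet ⟨fun r hr t ht s hs =>
      ⟨⟨hr.1.1.trans hs.1, hs.2.trans ht.1.2⟩, ht.2.mono_set ?_⟩⟩
    exact uIcc_subset_uIcc left_mem_uIcc (mem_uIcc_of_le (hr.1.1.trans hs.1) hs.2)
  have hA_sub : A ⊆ Icc a b := fun t ht => ht.1
  have hlip : LipschitzOnWith C.toNNReal y A := by
    refine LipschitzOnWith.of_dist_le_mul fun s hs t ht => ?_
    rw [dist_eq_norm, hy s hs.1, hy t ht.1, add_sub_add_left_eq_sub,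
      intervalIntegral.integral_interval_sub_left hs.2 ht.2, Real.dist_eq]
    refine (intervalIntegral.norm_integral_le_of_norm_le_const fun r _ => hC _ _).trans ?_
    gcongr
    exact Real.le_coe_toNNReal C
  have hconst : EqOn (fun _ => y a) y (Icc a b \ A) := by
    intro t ht
    have : ¬ IntervalIntegrable (fun s => f (y s) (u s)) volume a t := fun hi => ht.2 ⟨ht.1, hi⟩
    simp [hy t ht.1, intervalIntegral.integral_undef this]
  rw [← union_sdiff_cancel hA_sub, aestronglyMeasurable_union_iff]
  exact ⟨hlip.continuousOn.aestronglyMeasurable hA_meas,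
    aestronglyMeasurable_const.congr
      (hconst.aeEq_restrict (measurableSet_Icc.diff hA_meas))⟩

/-- A bounded continuous function is integrable along an admissible pair. -/
theorem IsAdmissible.intervalIntegrable {E : Type*} [NormedAddCommGroup E]
    [SecondCountableTopology E]
    {g : EuclideanSpace ℝ (Fin d) → EuclideanSpace ℝ (Fin m) → E}
    (h : IsAdmissible X U f a b y u) (hab : a ≤ b) (hfb : ∃ C, ∀ x v, ‖f x v‖ ≤ C)
    (hgc : Continuous fun p : EuclideanSpace ℝ (Fin d) × EuclideanSpace ℝ (Fin m) => g p.1 p.2)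
    (hgb : ∃ C, ∀ x v, ‖g x v‖ ≤ C) :
    IntervalIntegrable (fun s => g (y s) (u s)) volume a b := by
  obtain ⟨C, hC⟩ := hgb
  rw [intervalIntegrable_iff_integrableOn_Icc_of_le hab]
  exact IntegrableOn.of_bound measure_Icc_lt_top
    (hgc.comp_aestronglyMeasurable
      ((h.aestronglyMeasurable hfb).prodMk h.1.aestronglyMeasurable)) C
    (Filter.Eventually.of_forall fun s => hC _ _)

theorem IsAdmissible.left (h : IsAdmissible X U f a c y u) (hbc : b ≤ c) :
    IsAdmissible X U f a b y u :=
  have hsub : Icc a b ⊆ Icc a c := Icc_subset_Icc_right hbc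
  ⟨h.1, fun s hs => h.2.1 s (hsub hs), fun s hs => h.2.2.1 s (hsub hs),
    fun s hs => h.2.2.2 s (hsub hs)⟩

theorem IsAdmissible.right (h : IsAdmissible X U f a c y u) (hab : a ≤ b)
    (hfb : ∃ C, ∀ x v, ‖f x v‖ ≤ C)
    (hfc : Continuous fun p : EuclideanSpace ℝ (Fin d) × EuclideanSpace ℝ (Fin m) => f p.1 p.2) :
    IsAdmissible X U f b c y u := by
  have hsub : Icc b c ⊆ Icc a c := Icc_subset_Icc_left hab
  refine ⟨h.1, fun s hs => h.2.1 s (hsub hs), fun s hs => h.2.2.1 s (hsub hs), fun t ht => ?_⟩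
  have hint : ∀ s ∈ Icc a c, IntervalIntegrable (fun s => f (y s) (u s)) volume a s :=
    fun s hs => (h.left hs.2).intervalIntegrable hs.1 hfb hfc hfb
  have hb := hint b ⟨hab, ht.1.trans ht.2⟩
  rw [h.2.2.2 t (hsub ht), h.2.2.2 b ⟨hab, ht.1.trans ht.2⟩, add_assoc,
    intervalIntegral.integral_add_adjacent_intervals hb (hb.symm.trans (hint t (hsub ht)))]

theorem eqOn_uIoo_concat_left {α : Type*} {t : ℝ} (hat : a ≤ t) (htb : t ≤ b) (p q : ℝ → α) :
    EqOn ((Iic b).piecewise p q) p (uIoo a t) := by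
  rw [uIoo_of_le hat]
  exact (piecewise_eqOn _ _ _).mono fun s hs => hs.2.le.trans htb

theorem eqOn_uIoo_concat_right {α : Type*} {t : ℝ} (hbt : b ≤ t) (p q : ℝ → α) :
    EqOn ((Iic b).piecewise p q) q (uIoo b t) := by
  rw [uIoo_of_le hbt]
  exact (piecewise_eqOn_compl _ _ _).mono fun s hs => not_le.2 hs.1

/-- Admissible pairs on `[a,b]` and `[b,c]` whose trajectories agree at `b` can be glued. -/
theorem IsAdmissible.concat_s18 (hy : IsAdmissible X U f a b y u) (hz : IsAdmissible X U f b c z w)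
    (hab : a ≤ b) (hyz : z b = y b) (hfb : ∃ C, ∀ x v, ‖f x v‖ ≤ C)
    (hfc : Continuous fun p : EuclideanSpace ℝ (Fin d) × EuclideanSpace ℝ (Fin m) => f p.1 p.2) :
    IsAdmissible X U f a c ((Iic b).piecewise y z) ((Iic b).piecewise u w) := by
  refine ⟨hy.1.piecewise measurableSet_Iic hz.1, fun s hs => ?_, fun s hs => ?_, fun t ht => ?_⟩
  · by_cases h : s ≤ b
    · simpa [piecewise, h] using hy.2.1 s ⟨hs.1, h⟩
    · simpa [piecewise, h] using hz.2.1 s ⟨(not_le.1 h).le, hs.2⟩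
  · by_cases h : s ≤ b
    · simpa [piecewise, h] using hy.2.2.1 s ⟨hs.1, h⟩
    · simpa [piecewise, h] using hz.2.2.1 s ⟨(not_le.1 h).le, hs.2⟩
  · have hleft : ∀ r, a ≤ r → r ≤ b → EqOn (fun s => f (y s) (u s))
        (fun s => f ((Iic b).piecewise y z s) ((Iic b).piecewise u w s)) (uIoo a r) :=
      fun r har hrb s hs => by
        simp only [eqOn_uIoo_concat_left har hrb y z hs, eqOn_uIoo_concat_left har hrb u w hs]
    rw [piecewise_eq_of_mem (Iic b) y z (mem_Iic.2 hab)]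
    by_cases h : t ≤ b
    · rw [piecewise_eq_of_mem _ _ _ (mem_Iic.2 h), hy.2.2.2 t ⟨ht.1, h⟩,
        intervalIntegral.integral_congr_uIoo (hleft t ht.1 h)]
    · have hbt : b ≤ t := (not_le.1 h).le
      have hright : EqOn (fun s => f (z s) (w s))
          (fun s => f ((Iic b).piecewise y z s) ((Iic b).piecewise u w s)) (uIoo b t) :=
        fun s hs => by
          simp only [eqOn_uIoo_concat_right hbt y z hs, eqOn_uIoo_concat_right hbt u w hs]
      rw [piecewise_eq_of_notMem (Iic b) y z h, hz.2.2.2 t ⟨hbt, ht.2⟩, hyz,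
        hy.2.2.2 b (right_mem_Icc.2 hab), add_assoc,
        intervalIntegral.integral_congr_uIoo (hleft b hab le_rfl),
        intervalIntegral.integral_congr_uIoo hright,
        intervalIntegral.integral_add_adjacent_intervals
          ((hy.intervalIntegrable hab hfb hfc hfb).congr_uIoo (hleft b hab le_rfl))
          (((hz.left ht.2).intervalIntegrable hbt hfb hfc hfb).congr_uIoo hright)]

end Admissible

/-- Dynamic programming principle for the backward value function: for `0 ≤ t₀ ≤ t₁ ≤ T`,
`v←(x,t₀)` is the supremum over admissible pairs on `[t₀,t₁]` starting at `x` of the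
running cost plus `v←(y(t₁),t₁)`. -/
theorem backward_dynamic_programming_principle {d m : ℕ}
    (T : ℝ) (hT : 0 < T)
    (X : Set (EuclideanSpace ℝ (Fin d))) (hX : Bornology.IsBounded X)
    (U : Set (EuclideanSpace ℝ (Fin m)))
    (ℓ : EuclideanSpace ℝ (Fin d) → EuclideanSpace ℝ (Fin m) → ℝ)
    (hℓc : Continuous fun p : EuclideanSpace ℝ (Fin d) × EuclideanSpace ℝ (Fin m) => ℓ p.1 p.2)
    (hℓb : ∃ C, ∀ x u, |ℓ x u| ≤ C)
    (f : EuclideanSpace ℝ (Fin d) → EuclideanSpace ℝ (Fin m) → EuclideanSpace ℝ (Fin d))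
    (hfc : Continuous fun p : EuclideanSpace ℝ (Fin d) × EuclideanSpace ℝ (Fin m) => f p.1 p.2)
    (hfb : ∃ C, ∀ x u, ‖f x u‖ ≤ C)
    (φT : EuclideanSpace ℝ (Fin d) → ℝ)
    (hφTc : Continuous φT) (hφTb : ∃ C, ∀ x, |φT x| ≤ C)
    (x : EuclideanSpace ℝ (Fin d)) (t₀ t₁ : ℝ)
    (h0 : 0 ≤ t₀) (h01 : t₀ ≤ t₁) (h1T : t₁ ≤ T) :
    vBack X U f ℓ φT T x t₀ =
      ⨆ (p : (ℝ → EuclideanSpace ℝ (Fin d)) × (ℝ → EuclideanSpace ℝ (Fin m)))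
        (_ : IsAdmissible X U f t₀ t₁ p.1 p.2 ∧ p.1 t₀ = x),
          ((((∫ s in t₀..t₁, ℓ (p.1 s) (p.2 s)) : ℝ) : EReal) +
            vBack X U f ℓ φT T (p.1 t₁) t₁) := by
  have hint : ∀ {a b : ℝ} {y u}, IsAdmissible X U f a b y u → a ≤ b →
      IntervalIntegrable (fun s => ℓ (y s) (u s)) volume a b :=
    fun h hab => h.intervalIntegrable hab hfb hℓc hℓb
  apply le_antisymm
  · refine iSup₂_le fun p hp => ?_
    have hleft := hp.1.left h1T
    have hright := hp.1.right h01 hfb hfc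
    refine le_iSup₂_of_le p ⟨hleft, hp.2⟩ ?_
    rw [← intervalIntegral.integral_add_adjacent_intervals (hint hleft h01) (hint hright h1T),
      add_assoc, EReal.coe_add]
    gcongr
    exact le_iSup₂_of_le p ⟨hright, rfl⟩ le_rfl
  · refine iSup₂_le fun p hp => ?_
    rw [add_comm, ← EReal.le_sub_iff_add_le (.inl (EReal.coe_ne_bot _))
      (.inl (EReal.coe_ne_top _))]
    refine iSup₂_le fun q hq => ?_
    rw [EReal.le_sub_iff_add_le (.inl (EReal.coe_ne_bot _)) (.inl (EReal.coe_ne_top _)),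
      ← EReal.coe_add]
    have hpq := hp.1.concat_s18 hq.1 h01 hq.2 hfb hfc
    refine le_iSup₂_of_le ((Iic t₁).piecewise p.1 q.1, (Iic t₁).piecewise p.2 q.2)
      ⟨hpq, ?_⟩ (EReal.coe_le_coe_iff.2 (le_of_eq ?_))
    · exact (piecewise_eq_of_mem _ _ _ (mem_Iic.2 h01)).trans hp.2
    · have hend : (Iic t₁).piecewise p.1 q.1 T = q.1 T := by
        rcases h1T.eq_or_lt with rfl | h
        · simpa [piecewise] using hq.2.symm
        · simp [piecewise, h]
      have hfirst : ∫ s in t₀..t₁, ℓ ((Iic t₁).piecewise p.1 q.1 s)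
          ((Iic t₁).piecewise p.2 q.2 s) = ∫ s in t₀..t₁, ℓ (p.1 s) (p.2 s) :=
        intervalIntegral.integral_congr_uIoo fun s hs => by
          simp only [eqOn_uIoo_concat_left h01 le_rfl _ _ hs]
      have hsecond : ∫ s in t₁..T, ℓ ((Iic t₁).piecewise p.1 q.1 s)
          ((Iic t₁).piecewise p.2 q.2 s) = ∫ s in t₁..T, ℓ (q.1 s) (q.2 s) :=
        intervalIntegral.integral_congr_uIoo fun s hs => by
          simp only [eqOn_uIoo_concat_right h1T _ _ hs]
      dsimp only
      rw [hend, ← intervalIntegral.integral_add_adjacent_intervals (hint (hpq.left h1T) h01)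
        (hint (hpq.right h01 hfb hfc) h1T), hfirst, hsecond]
      ring
end
end
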